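/- Consider the curve C := {(x, f₂(x), …, f_n(x)) : x ∈ I₀}, where f₂, …, f_n are locally Lipschitz on a finite interval I₀ ⊂ ℝ. Let Φ and Ψ be approximating functions, and suppose (R_C(Φ), β) is a locally ubiquitous system with respect to ρ. If Ψ(2^{t+1}) ≤ (1/2) Ψ(2^t) for all sufficiently large t and ∑_{t=1}^∞ Ψ(2^t)/ρ(2^t) = ∞, then the set Λ(R_C(Φ), β, Ψ) has full Lebesgue measure in I₀. -/

import Mathlib

open MeasureTheory Filter

/-- An approximating function: a decreasing function `ℝ₊ → ℝ₊` taking positive values. -/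
def IsApproxFun (Ψ : ℝ → ℝ) : Prop :=
  (∀ x y : ℝ, 0 < x → x ≤ y → Ψ y ≤ Ψ x) ∧ ∀ x : ℝ, 0 < x → 0 < Ψ x

/-- The index set `J_C(Φ)` of resonant points which are `Φ`-close to the curve
`x ↦ (x, f 0 x, …, f (m-1) x)`.  Here `R1 α` is the first coordinate of the
resonant point `R_α` and `Rr α` are its remaining `m` coordinates. -/
def JC {J : Type*} {m : ℕ} (f : Fin m → ℝ → ℝ) (R1 : J → ℝ) (Rr : J → Fin m → ℝ)
    (β : J → ℝ) (Φ : ℝ → ℝ) : Set J :=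
  {α | ∀ k : Fin m, |f k (R1 α) - Rr α k| < Φ (β α)}

/-- `(R_C(Φ), β)` is a locally ubiquitous system with respect to `ρ`:
the first coordinates of the resonant points `Φ`-close to the curve form a
locally ubiquitous system in `I₀` with respect to `ρ`. -/
def LocUbiqCurve (I₀ : Set ℝ) {J : Type*} {m : ℕ} (f : Fin m → ℝ → ℝ)
    (R1 : J → ℝ) (Rr : J → Fin m → ℝ) (β : J → ℝ) (Φ ρ : ℝ → ℝ) : Prop :=
  ∃ κ : ℝ, 0 < κ ∧ ∀ I ⊆ I₀, I.OrdConnected →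
    ENNReal.ofReal κ * volume I ≤
      liminf (fun t : ℕ =>
        volume (⋃ α ∈ {α : J | β α ≤ (2 : ℝ) ^ t ∧ α ∈ JC f R1 Rr β Φ},
          Metric.ball (R1 α) (ρ ((2 : ℝ) ^ t)) ∩ I)) atTop

/-- The set `Λ(R_C(Φ), β, Ψ)`. -/
def LambdaCurve (I₀ : Set ℝ) {J : Type*} {m : ℕ} (f : Fin m → ℝ → ℝ)
    (R1 : J → ℝ) (Rr : J → Fin m → ℝ) (β : J → ℝ) (Φ Ψ : ℝ → ℝ) : Set ℝ :=
  {x | x ∈ I₀ ∧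
    {α : J | |x - R1 α| < Ψ (β α) ∧
      ∀ k : Fin m, |f k x - Rr α k| < Ψ (β α) + Φ (β α)}.Infinite}

/-- Second moment inequality for the measure of a finite union. -/
lemma two_mul_sum_measureReal_le {Ω ι : Type*} [MeasurableSpace Ω] (μ : Measure Ω)
    (F : Finset ι) (A : ι → Set Ω) (hA : ∀ i, MeasurableSet (A i)) (hfin : ∀ i, μ (A i) ≠ ⊤)
    (c : ℝ) :
    2 * c * ∑ i ∈ F, μ.real (A i) ≤
      ∑ i ∈ F, ∑ j ∈ F, μ.real (A i ∩ A j) + c ^ 2 * μ.real (⋃ i ∈ F, A i) := by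
  have hU : MeasurableSet (⋃ i ∈ F, A i) := F.measurableSet_biUnion fun i _ => hA i
  have hUfin : μ (⋃ i ∈ F, A i) ≠ ⊤ :=
    ((measure_biUnion_finset_le F A).trans_lt
      (ENNReal.sum_lt_top.2 fun i _ => (hfin i).lt_top)).ne
  have hint : ∀ s : Set Ω, MeasurableSet s → μ s ≠ ⊤ →
      Integrable (s.indicator (1 : Ω → ℝ)) μ := fun s hs h =>
    (integrable_indicator_iff hs).2 (integrableOn_const h)
  have hIfin : ∀ i j, μ (A i ∩ A j) ≠ ⊤ := fun i j =>
    ((measure_mono Set.inter_subset_left).trans_lt (hfin i).lt_top).ne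
  have hlhs : 2 * c * ∑ i ∈ F, μ.real (A i) =
      ∫ x, 2 * c * ∑ i ∈ F, (A i).indicator (1 : Ω → ℝ) x ∂μ := by
    rw [integral_const_mul, integral_finsetSum _ fun i _ => hint _ (hA i) (hfin i)]
    simp_rw [integral_indicator_one (hA _)]
  have hint₁ : ∀ i j, Integrable ((A i ∩ A j).indicator (1 : Ω → ℝ)) μ := fun i j =>
    hint _ ((hA i).inter (hA j)) (hIfin i j)
  have hint₂ : Integrable
      (fun x => ∑ i ∈ F, ∑ j ∈ F, (A i ∩ A j).indicator (1 : Ω → ℝ) x) μ :=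
    integrable_finsetSum _ fun i _ => integrable_finsetSum _ fun j _ => hint₁ i j
  have hrhs : ∑ i ∈ F, ∑ j ∈ F, μ.real (A i ∩ A j) + c ^ 2 * μ.real (⋃ i ∈ F, A i) =
      ∫ x, (∑ i ∈ F, ∑ j ∈ F, (A i ∩ A j).indicator (1 : Ω → ℝ) x) +
        c ^ 2 * (⋃ i ∈ F, A i).indicator (1 : Ω → ℝ) x ∂μ := by
    rw [integral_add hint₂ ((hint _ hU hUfin).const_mul _), integral_const_mul,
      integral_indicator_one hU,
      integral_finsetSum _ fun i _ => integrable_finsetSum _ fun j _ => hint₁ i j]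
    congr 1
    refine Finset.sum_congr rfl fun i _ => ?_
    rw [integral_finsetSum _ fun j _ => hint₁ i j]
    exact Finset.sum_congr rfl fun j _ => (integral_indicator_one ((hA i).inter (hA j))).symm
  rw [hlhs, hrhs]
  refine integral_mono ((integrable_finsetSum _ fun i _ => hint _ (hA i) (hfin i)).const_mul _)
    (hint₂.add ((hint _ hU hUfin).const_mul _)) fun x => ?_
  have hsq : ∑ i ∈ F, ∑ j ∈ F, (A i ∩ A j).indicator (1 : Ω → ℝ) x =
      (∑ i ∈ F, (A i).indicator (1 : Ω → ℝ) x) ^ 2 := by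
    rw [sq, Finset.sum_mul_sum]
    refine Finset.sum_congr rfl fun i _ => Finset.sum_congr rfl fun j _ => ?_
    rw [Set.inter_indicator_one, Pi.mul_apply]
  simp only [hsq]
  by_cases hx : x ∈ ⋃ i ∈ F, A i
  · rw [Set.indicator_of_mem hx, Pi.one_apply]
    nlinarith [sq_nonneg (∑ i ∈ F, (A i).indicator (1 : Ω → ℝ) x - c)]
  · have h0 : ∑ i ∈ F, (A i).indicator (1 : Ω → ℝ) x = 0 :=
      Finset.sum_eq_zero fun i hi => Set.indicator_of_notMem
        (fun h => hx (Set.mem_biUnion hi h)) _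
    rw [Set.indicator_of_notMem hx, h0]
    simp

/-- Every finite set of reals has a maximal `δ`-separated subset. -/
lemma Finset.exists_separated_subset_real (F : Finset ℝ) {δ : ℝ} (hδ : 0 < δ) :
    ∃ G ⊆ F, (∀ x ∈ G, ∀ y ∈ G, x ≠ y → δ ≤ |x - y|) ∧ ∀ x ∈ F, ∃ y ∈ G, |x - y| < δ := by
  classical
  induction F using Finset.induction_on with
  | empty => exact ⟨∅, by simp⟩
  | insert a F _ ih =>
    obtain ⟨G, hGF, hsep, hnet⟩ := ih
    by_cases h : ∃ y ∈ G, |a - y| < δ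
    · refine ⟨G, hGF.trans (Finset.subset_insert _ _), hsep, fun x hx => ?_⟩
      rcases Finset.mem_insert.1 hx with rfl | hx
      exacts [h, hnet x hx]
    · push Not at h
      refine ⟨insert a G, Finset.insert_subset_insert _ hGF, ?_, fun x hx => ?_⟩
      · intro x hx y hy hxy
        rcases Finset.mem_insert.1 hx with hxa | hxG <;>
          rcases Finset.mem_insert.1 hy with hya | hyG
        · exact absurd (hxa.trans hya.symm) hxy
        · exact hxa ▸ h y hyG
        · rw [abs_sub_comm]
          exact hya ▸ h x hxG
        · exact hsep x hxG y hyG hxy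
      · rcases Finset.mem_insert.1 hx with rfl | hx
        · exact ⟨x, Finset.mem_insert_self _ _, by simpa using hδ⟩
        · obtain ⟨y, hy, hxy⟩ := hnet x hx
          exact ⟨y, Finset.mem_insert_of_mem hy, hxy⟩

lemma volume_real_biUnion_ball_le (G : Finset ℝ) {ψ : ℝ} (hψ : 0 ≤ ψ) :
    volume.real (⋃ g ∈ G, Metric.ball g ψ) ≤ G.card * (2 * ψ) := by
  refine (measureReal_biUnion_finset_le G _).trans_eq ?_
  simp [Real.volume_real_ball hψ]

lemma volume_real_biUnion_ball (G : Finset ℝ) {ψ : ℝ} (hψ : 0 ≤ ψ)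
    (hG : ∀ x ∈ G, ∀ y ∈ G, x ≠ y → 2 * ψ ≤ |x - y|) :
    volume.real (⋃ g ∈ G, Metric.ball g ψ) = G.card * (2 * ψ) := by
  rw [measureReal_biUnion_finset]
  · simp [Real.volume_real_ball hψ]
  · intro x hx y hy hxy
    refine Metric.ball_disjoint_ball ?_
    rw [Real.dist_eq]
    linarith [hG x hx y hy hxy]
  · exact fun _ _ => measurableSet_ball

/-- Packing bound for separated points in an interval. -/
lemma card_mul_le_of_separated (G : Finset ℝ) {ρ R a : ℝ} (hρ : 0 ≤ ρ) (hR : 0 ≤ R)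
    (hG : ∀ x ∈ G, ∀ y ∈ G, x ≠ y → 2 * ρ ≤ |x - y|) (ha : ∀ x ∈ G, |x - a| ≤ R) :
    G.card * ρ ≤ R + ρ := by
  have h := measureReal_mono (μ := volume) (s₁ := ⋃ g ∈ G, Metric.ball g ρ)
    (s₂ := Metric.ball a (R + ρ)) (Set.iUnion₂_subset fun g hg => Metric.ball_subset_ball' (by
      rw [Real.dist_eq]
      linarith [ha g hg])) measure_ball_lt_top.ne
  rw [volume_real_biUnion_ball G hρ hG, Real.volume_real_ball (by positivity)] at h
  linarith

/-- A short interval meets the `ψ`-neighbourhood of a `2ρ`-separated set in a small set. -/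
lemma volume_real_ball_inter_biUnion_ball_le (G : Finset ℝ) {ψ ρ σ a : ℝ} (hψ : 0 ≤ ψ)
    (hψρ : ψ ≤ ρ) (hρ : 0 < ρ) (hσ : 0 ≤ σ)
    (hG : ∀ x ∈ G, ∀ y ∈ G, x ≠ y → 2 * ρ ≤ |x - y|) :
    volume.real (Metric.ball a σ ∩ ⋃ g ∈ G, Metric.ball g ψ) ≤ (σ / ρ + 2) * (2 * ψ) := by
  classical
  set H := G.filter fun g => |g - a| ≤ σ + ψ with hH
  have hsub : Metric.ball a σ ∩ ⋃ g ∈ G, Metric.ball g ψ ⊆ ⋃ g ∈ H, Metric.ball g ψ := by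
    rintro y ⟨hya, hy⟩
    obtain ⟨g, hg, hyg⟩ := Set.mem_iUnion₂.1 hy
    refine Set.mem_biUnion (Finset.mem_filter.2 ⟨hg, ?_⟩) hyg
    rw [Metric.mem_ball, Real.dist_eq] at hya hyg
    have := abs_sub_le g y a
    rw [abs_sub_comm g y] at this
    linarith
  have hcard := card_mul_le_of_separated H (a := a) (R := σ + ψ) hρ.le (by positivity)
    (fun x hx y hy => hG x (Finset.mem_filter.1 hx).1 y (Finset.mem_filter.1 hy).1)
    (fun x hx => (Finset.mem_filter.1 hx).2)
  have hcard' : (H.card : ℝ) ≤ σ / ρ + 2 := by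
    rw [div_add' _ _ _ hρ.ne', le_div_iff₀ hρ]
    linarith
  have hfin : volume (⋃ g ∈ H, Metric.ball g ψ) ≠ ⊤ :=
    ((measure_biUnion_finset_le H _).trans_lt
      (ENNReal.sum_lt_top.2 fun _ _ => measure_ball_lt_top)).ne
  calc _ ≤ volume.real (⋃ g ∈ H, Metric.ball g ψ) := measureReal_mono hsub hfin
    _ ≤ H.card * (2 * ψ) := volume_real_biUnion_ball_le H hψ
    _ ≤ _ := by gcongr

/-- The tail sums of a sequence that halves at every step are controlled by the first term. -/
lemma sum_Ico_le_two_mul_of_halving {ψ : ℕ → ℝ} {m : ℕ} (hpos : ∀ t, 0 < ψ t)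
    (hhalf : ∀ t ≥ m, ψ (t + 1) ≤ ψ t / 2) {s : ℕ} (hs : m ≤ s) (N : ℕ) :
    ∑ t ∈ Finset.Ico s N, ψ t ≤ 2 * ψ s := by
  rcases le_total s N with h | h
  · suffices ∑ t ∈ Finset.Ico s N, ψ t ≤ 2 * ψ s - 2 * ψ N by linarith [hpos N]
    induction N, h using Nat.le_induction with
    | base => simp
    | succ N hN ih =>
      rw [Finset.sum_Ico_succ_top hN]
      linarith [hhalf N (hs.trans hN)]
  · rw [Finset.Ico_eq_empty_of_le h, Finset.sum_empty]
    linarith [hpos s]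

/-- The measure of a union of neighbourhoods of well-spaced finite sets with divergent total
measure is bounded below. -/
lemma le_volume_real_of_separated {ψ ρ : ℕ → ℝ} {G : ℕ → Finset ℝ} {m : ℕ} {r κ x : ℝ}
    (hr : 0 < r) (hκ : 0 < κ) (hψ : ∀ t, 0 < ψ t) (hρ : ∀ t, 0 < ρ t)
    (hψρ : ∀ t ≥ m, ψ t ≤ ρ t) (hhalf : ∀ t ≥ m, ψ (t + 1) ≤ ψ t / 2)
    (hdiv : ¬ Summable fun t => ψ t / ρ t)
    (hsep : ∀ t ≥ m, ∀ y ∈ G t, ∀ z ∈ G t, y ≠ z → 2 * ρ t ≤ |y - z|)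
    (hup : ∀ t ≥ m, (G t).card * ρ t ≤ r) (hlow : ∀ t ≥ m, κ * r ≤ (G t).card * ρ t)
    (hball : ∀ t ≥ m, (⋃ g ∈ G t, Metric.ball g (ψ t)) ⊆ Metric.closedBall x r) :
    2 / 9 * κ ^ 2 * r ≤ volume.real (⋃ t ≥ m, ⋃ g ∈ G t, Metric.ball g (ψ t)) := by
  set b : ℕ → ℝ := fun t => ψ t / ρ t with hb
  have hbpos : ∀ t, 0 < b t := fun t => div_pos (hψ t) (hρ t)
  set A : ℕ → Set ℝ := fun t => ⋃ g ∈ G t, Metric.ball g (ψ t) with hA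
  have hAmeas : ∀ t, MeasurableSet (A t) := fun t =>
    (G t).measurableSet_biUnion fun _ _ => measurableSet_ball
  have hAfin : ∀ t, volume (A t) ≠ ⊤ := fun t =>
    ((measure_biUnion_finset_le (G t) _).trans_lt
      (ENNReal.sum_lt_top.2 fun _ _ => measure_ball_lt_top)).ne
  obtain ⟨N, hN⟩ : ∃ N, 1 ≤ ∑ t ∈ Finset.Ico m N, b t := by
    have hs : ¬ Summable fun t => b (t + m) := fun h => hdiv ((summable_nat_add_iff m).1 h)
    have ht := (not_summable_iff_tendsto_nat_atTop_of_nonneg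
      (fun t => (hbpos (t + m)).le)).1 hs
    obtain ⟨M, hM⟩ := (ht.eventually_ge_atTop 1).exists
    refine ⟨m + M, hM.trans_eq ?_⟩
    rw [Finset.sum_Ico_eq_sum_range, Nat.add_sub_cancel_left]
    simp_rw [Nat.add_comm]
  set S := ∑ t ∈ Finset.Ico m N, b t with hS
  have hmem : ∀ {t}, t ∈ Finset.Ico m N → m ≤ t := fun h => (Finset.mem_Ico.1 h).1
  have hAlow : κ * r * 2 * S ≤ ∑ t ∈ Finset.Ico m N, volume.real (A t) := by
    rw [hS, Finset.mul_sum]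
    refine Finset.sum_le_sum fun t ht => ?_
    have hm := hmem ht
    rw [volume_real_biUnion_ball (G t) (hψ t).le fun y hy z hz hyz => by
      linarith [hsep t hm y hy z hz hyz, hψρ t hm]]
    have h := mul_le_mul_of_nonneg_right (hlow t hm) (by linarith [hbpos t] : 0 ≤ 2 * b t)
    have h2 : ((G t).card * ρ t) * (2 * b t) = (G t).card * (2 * ψ t) := by
      have := (hρ t).ne'
      simp only [hb]
      field_simp
    linarith
  set P : ℕ → ℕ → ℝ := fun s t => if s ≤ t then ψ t / ρ s else 0 with hP
  have hPnonneg : ∀ s t, 0 ≤ P s t := fun s t => by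
    simp only [hP]
    split_ifs
    exacts [(div_pos (hψ t) (hρ s)).le, le_rfl]
  have hle : ∀ s t, m ≤ s → s ≤ t →
      volume.real (A s ∩ A t) ≤ 2 * r * (b s * b t) + 4 * r * P s t := by
    intro s t hs hst
    have ht := hs.trans hst
    have h1 : volume.real (A s ∩ A t) ≤ (G s).card * ((ψ s / ρ t + 2) * (2 * ψ t)) := by
      have : A s ∩ A t = ⋃ g ∈ G s, (Metric.ball g (ψ s) ∩ A t) := by
        simp only [hA, Set.iUnion_inter]
      rw [this]
      refine (measureReal_biUnion_finset_le (G s) _).trans ?_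
      refine (Finset.sum_le_card_nsmul _ _ _ fun g _ =>
        volume_real_ball_inter_biUnion_ball_le (G t) (hψ t).le (hψρ t ht) (hρ t) (hψ s).le
          (hsep t ht)).trans_eq ?_
      rw [nsmul_eq_mul]
    have h2 : ((G s).card : ℝ) ≤ r / ρ s := by
      rw [le_div_iff₀ (hρ s)]
      exact hup s hs
    have h3 : 0 ≤ (ψ s / ρ t + 2) * (2 * ψ t) := by
      have := hψ s; have := hψ t; have := hρ t
      positivity
    refine (h1.trans (mul_le_mul_of_nonneg_right h2 h3)).trans_eq ?_
    simp only [hP, hb, if_pos hst]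
    have := (hρ s).ne'; have := (hρ t).ne'
    field_simp
    ring
  have hpair : ∀ s t, m ≤ s → m ≤ t →
      volume.real (A s ∩ A t) ≤ 2 * r * (b s * b t) + 4 * r * (P s t + P t s) := by
    intro s t hs ht
    rcases le_total s t with h | h
    · nlinarith [hle s t hs h, hPnonneg t s]
    · have := hle t s ht h
      rw [Set.inter_comm] at this
      nlinarith [hPnonneg s t]
  have hPsum : ∑ s ∈ Finset.Ico m N, ∑ t ∈ Finset.Ico m N, P s t ≤ 2 * S := by
    rw [hS, Finset.mul_sum]
    refine Finset.sum_le_sum fun s hs => ?_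
    have h1 : ∑ t ∈ Finset.Ico m N, P s t = (∑ t ∈ Finset.Ico s N, ψ t) / ρ s := by
      rw [Finset.sum_div]
      simp only [hP]
      rw [← Finset.sum_filter]
      congr 1
      ext t
      have := hmem hs
      simp only [Finset.mem_filter, Finset.mem_Ico]
      omega
    rw [h1]
    simp only [hb]
    rw [← mul_div_assoc]
    exact div_le_div_of_nonneg_right (sum_Ico_le_two_mul_of_halving hψ hhalf (hmem hs) N)
      (hρ s).le
  have hT : ∑ s ∈ Finset.Ico m N, ∑ t ∈ Finset.Ico m N, volume.real (A s ∩ A t) ≤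
      2 * r * S ^ 2 + 4 * r * (4 * S) := by
    calc _ ≤ ∑ s ∈ Finset.Ico m N, ∑ t ∈ Finset.Ico m N,
          (2 * r * (b s * b t) + 4 * r * (P s t + P t s)) :=
        Finset.sum_le_sum fun s hs => Finset.sum_le_sum fun t ht => hpair s t (hmem hs) (hmem ht)
      _ = 2 * r * S ^ 2 + 4 * r * (∑ s ∈ Finset.Ico m N, ∑ t ∈ Finset.Ico m N, P s t +
          ∑ s ∈ Finset.Ico m N, ∑ t ∈ Finset.Ico m N, P s t) := by
        simp only [Finset.sum_add_distrib, ← Finset.mul_sum]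
        rw [Finset.sum_comm (f := fun s t => P t s), sq, hS, Finset.sum_mul]
      _ ≤ _ := by
        have : (0 : ℝ) ≤ 4 * r := by positivity
        nlinarith
  have hU : volume.real (⋃ t ∈ Finset.Ico m N, A t) ≤ volume.real (⋃ t ≥ m, A t) := by
    refine measureReal_mono (Set.iUnion₂_subset fun t ht => ?_) ?_
    · exact Set.subset_biUnion_of_mem (u := A) (show t ∈ {t | t ≥ m} from hmem ht)
    · exact ((measure_mono (Set.iUnion₂_subset fun t ht => hball t ht)).trans_lt
        measure_closedBall_lt_top).ne
  refine le_trans ?_ hU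
  set v := volume.real (⋃ t ∈ Finset.Ico m N, A t)
  have hSpos : 0 < S := by linarith
  have hmain := two_mul_sum_measureReal_le volume (Finset.Ico m N) A hAmeas hAfin (9 * S / κ)
  have h1 : 2 * (9 * S / κ) * (κ * r * 2 * S) ≤
      2 * (9 * S / κ) * ∑ t ∈ Finset.Ico m N, volume.real (A t) :=
    mul_le_mul_of_nonneg_left hAlow (by positivity)
  have h2 : r * S ≤ r * S ^ 2 := by nlinarith [mul_pos hr hSpos]
  have h3 : 2 * (9 * S / κ) * (κ * r * 2 * S) = 36 * (r * S ^ 2) := by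
    field_simp
    ring
  have h4 : 18 * (r * S ^ 2) ≤ (9 * S / κ) ^ 2 * v := by linarith
  have h5 : (9 * S / κ) ^ 2 * (2 / 9 * κ ^ 2 * r) = 18 * (r * S ^ 2) := by
    field_simp
    ring
  exact le_of_mul_le_mul_left (h5.trans_le h4) (by positivity)

/-- A finite set of points whose `ρ`-neighbourhood fills a proportion of an interval contains
a well-spaced subset of the right cardinality near that interval. -/
lemma Finset.exists_wellSpaced_subset_real (F : Finset ℝ) {ρ κ r x : ℝ} (hρ : 0 < ρ)
    (hρr : ρ ≤ r / 4)
    (hF : κ * r ≤ volume.real ((⋃ p ∈ F, Metric.ball p ρ) ∩ Metric.closedBall x (r / 2))) :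
    ∃ G ⊆ F, (∀ y ∈ G, ∀ z ∈ G, y ≠ z → 2 * ρ ≤ |y - z|) ∧
      (∀ g ∈ G, |g - x| ≤ 3 * r / 4) ∧ G.card * ρ ≤ r ∧ κ / 6 * r ≤ G.card * ρ := by
  classical
  obtain ⟨G, hGF, hsep, hnet⟩ :=
    (F.filter fun g => |g - x| ≤ 3 * r / 4).exists_separated_subset_real
      (by positivity : 0 < 2 * ρ)
  have hG : ∀ g ∈ G, |g - x| ≤ 3 * r / 4 := fun g hg => (Finset.mem_filter.1 (hGF hg)).2
  refine ⟨G, hGF.trans (Finset.filter_subset _ _), hsep, hG, ?_, ?_⟩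
  · have := card_mul_le_of_separated G hρ.le (by linarith : 0 ≤ 3 * r / 4) hsep hG
    linarith
  · have hsub : (⋃ p ∈ F, Metric.ball p ρ) ∩ Metric.closedBall x (r / 2) ⊆
        ⋃ g ∈ G, Metric.ball g (3 * ρ) := by
      rintro y ⟨hy, hyx⟩
      obtain ⟨p, hp, hyp⟩ := Set.mem_iUnion₂.1 hy
      rw [Metric.mem_ball, Real.dist_eq] at hyp
      rw [Metric.mem_closedBall, Real.dist_eq] at hyx
      have h1 := abs_sub_le p y x
      rw [abs_sub_comm p y] at h1
      obtain ⟨g, hg, hpg⟩ := hnet p (Finset.mem_filter.2 ⟨hp, by linarith⟩)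
      refine Set.mem_biUnion hg ?_
      rw [Metric.mem_ball, Real.dist_eq]
      linarith [abs_sub_le y p g]
    have hfin : volume (⋃ g ∈ G, Metric.ball g (3 * ρ)) ≠ ⊤ :=
      ((measure_biUnion_finset_le G _).trans_lt
        (ENNReal.sum_lt_top.2 fun _ _ => measure_ball_lt_top)).ne
    have := hF.trans ((measureReal_mono hsub hfin).trans
      (volume_real_biUnion_ball_le G (by positivity)))
    linarith

/-- A sequence of positive reals which eventually halves at every step tends to zero. -/
lemma tendsto_zero_of_eventually_halving {ψ : ℕ → ℝ} (hpos : ∀ t, 0 < ψ t)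
    (hhalf : ∀ᶠ t in atTop, ψ (t + 1) ≤ ψ t / 2) : Tendsto ψ atTop (nhds 0) := by
  obtain ⟨m, hm⟩ := eventually_atTop.1 hhalf
  refine Summable.tendsto_atTop_zero ?_
  rw [← summable_nat_add_iff m]
  refine summable_of_sum_range_le (c := 2 * ψ m) (fun t => (hpos _).le) fun N => ?_
  have := sum_Ico_le_two_mul_of_halving hpos hm le_rfl (m + N)
  rw [Finset.sum_Ico_eq_sum_range, Nat.add_sub_cancel_left] at this
  simpa only [Nat.add_comm] using this

/-- Local form of the divergence Borel–Cantelli lemma for ubiquitous systems on the line. -/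
lemma le_volume_real_limsup_of_ubiquitous {J : Type*} {p : J → ℝ} {D : ℕ → Set J}
    (hD : ∀ t, (D t).Finite) {ψ ρ : ℕ → ℝ} {κ r x : ℝ} (hr : 0 < r) (hκ : 0 < κ)
    (hψ : ∀ t, 0 < ψ t) (hρ : ∀ t, 0 < ρ t) (hρ0 : Tendsto ρ atTop (nhds 0))
    (hhalf : ∀ᶠ t in atTop, ψ (t + 1) ≤ ψ t / 2) (hdiv : ¬ Summable fun t => ψ t / ρ t)
    (hub : ∀ᶠ t in atTop, κ * r ≤
      volume.real ((⋃ α ∈ D t, Metric.ball (p α) (ρ t)) ∩ Metric.closedBall x (r / 2))) :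
    MeasurableSet {y ∈ Metric.closedBall x r | ∃ᶠ t in atTop,
      ∃ α ∈ D t, p α ∈ Metric.closedBall x r ∧ |y - p α| < ψ t} ∧
    min κ (2 / 9 * (κ / 6) ^ 2) * r ≤
      volume.real {y ∈ Metric.closedBall x r | ∃ᶠ t in atTop,
        ∃ α ∈ D t, p α ∈ Metric.closedBall x r ∧ |y - p α| < ψ t} := by
  classical
  set E : ℕ → Set ℝ := fun m => (⋃ t ≥ m, ⋃ α ∈ {α ∈ D t | p α ∈ Metric.closedBall x r},
    Metric.ball (p α) (ψ t)) ∩ Metric.closedBall x r with hE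
  have hEfin : ∀ m, volume (E m) ≠ ⊤ := fun m =>
    ((measure_mono Set.inter_subset_right).trans_lt measure_closedBall_lt_top).ne
  have hEmeas : ∀ m, MeasurableSet (E m) := fun m => by
    refine MeasurableSet.inter ?_ measurableSet_closedBall
    exact (isOpen_biUnion fun t _ => isOpen_biUnion fun α _ => Metric.isOpen_ball).measurableSet
  have hEanti : Antitone E := fun m n hmn => by
    refine Set.inter_subset_inter_left _ ?_
    exact Set.biUnion_subset_biUnion_left fun t (ht : n ≤ t) => hmn.trans ht
  have hEinter : {y ∈ Metric.closedBall x r | ∃ᶠ t in atTop,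
      ∃ α ∈ D t, p α ∈ Metric.closedBall x r ∧ |y - p α| < ψ t} = ⋂ m, E m := by
    ext y
    simp only [hE, frequently_atTop, Set.mem_ofPred_eq, Set.mem_iInter, Set.mem_inter_iff,
      Set.mem_iUnion, Metric.mem_ball, Real.dist_eq, exists_prop, and_assoc]
    exact ⟨fun h m => ⟨h.2 m, h.1⟩, fun h => ⟨(h 0).2, fun m => (h m).1⟩⟩
  have hbound : ∀ᶠ m in atTop, min κ (2 / 9 * (κ / 6) ^ 2) * r ≤ volume.real (E m) := by
    have hψ0 := tendsto_zero_of_eventually_halving hψ hhalf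
    have hr4 : 0 < r / 4 := by positivity
    obtain ⟨m₀, hm₀⟩ := eventually_atTop.1 (((hψ0.eventually_lt_const hr4).and
      (hρ0.eventually_lt_const hr4)).and (hhalf.and hub))
    filter_upwards [eventually_ge_atTop m₀] with m hm
    by_cases hcase : ∃ t ≥ m, ρ t < ψ t
    · obtain ⟨t, ht, hlt⟩ := hcase
      obtain ⟨⟨-, hρt⟩, -, hubt⟩ := hm₀ t (hm.trans ht)
      refine (mul_le_mul_of_nonneg_right (min_le_left _ _) hr.le).trans
        (hubt.trans (measureReal_mono ?_ (hEfin m)))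
      rintro y ⟨hy, hyx⟩
      obtain ⟨α, hα, hyα⟩ := Set.mem_iUnion₂.1 hy
      rw [Metric.mem_closedBall] at hyx
      rw [Metric.mem_ball] at hyα
      refine ⟨Set.mem_biUnion (show t ∈ {t | t ≥ m} from ht) (Set.mem_biUnion (x := α)
        ⟨hα, ?_⟩ (Metric.mem_ball.2 (hyα.trans hlt))), ?_⟩
      · rw [Metric.mem_closedBall]
        linarith [dist_triangle_left (p α) x y]
      · rw [Metric.mem_closedBall]
        linarith
    · push Not at hcase
      have hex : ∀ t, ∃ G : Finset ℝ, t ≥ m → (∀ g ∈ G, ∃ α ∈ D t, p α = g) ∧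
          (∀ y ∈ G, ∀ z ∈ G, y ≠ z → 2 * ρ t ≤ |y - z|) ∧
          (∀ g ∈ G, |g - x| ≤ 3 * r / 4) ∧ G.card * ρ t ≤ r ∧ κ / 6 * r ≤ G.card * ρ t := by
        intro t
        by_cases ht : t ≥ m
        · obtain ⟨⟨-, hρt⟩, -, hubt⟩ := hm₀ t (hm.trans ht)
          obtain ⟨G, hGF, hG⟩ := ((hD t).toFinset.image p).exists_wellSpaced_subset_real
            (κ := κ) (x := x) (hρ t) hρt.le (by simpa using hubt)
          refine ⟨G, fun _ => ⟨fun g hg => ?_, hG⟩⟩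
          simpa using hGF hg
        · exact ⟨∅, fun h => absurd h ht⟩
      choose G hG using hex
      have hball : ∀ t ≥ m, (⋃ g ∈ G t, Metric.ball g (ψ t)) ⊆ Metric.closedBall x r := by
        intro t ht
        refine Set.iUnion₂_subset fun g hg => ?_
        refine Metric.ball_subset_closedBall.trans (Metric.closedBall_subset_closedBall' ?_)
        have h1 := (hG t ht).2.2.1 g hg
        have h2 := (hm₀ t (hm.trans ht)).1.1
        rw [Real.dist_eq]
        linarith
      have h := le_volume_real_of_separated hr (by positivity : 0 < κ / 6) hψ hρ hcase
        (fun t ht => (hm₀ t (hm.trans ht)).2.1) hdiv (fun t ht => (hG t ht).2.1)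
        (fun t ht => (hG t ht).2.2.2.1) (fun t ht => (hG t ht).2.2.2.2) hball
      refine (mul_le_mul_of_nonneg_right (min_le_right _ _) hr.le).trans
        (h.trans (measureReal_mono (Set.iUnion₂_subset fun t ht => ?_) (hEfin m)))
      refine fun y hy => ⟨Set.mem_biUnion (show t ∈ {t | t ≥ m} from ht) ?_, hball t ht hy⟩
      obtain ⟨g, hg, hyg⟩ := Set.mem_iUnion₂.1 hy
      obtain ⟨α, hα, rfl⟩ := (hG t ht).1 g hg
      refine Set.mem_biUnion (x := α) ⟨hα, ?_⟩ hyg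
      rw [Metric.mem_closedBall, Real.dist_eq]
      linarith [(hG t ht).2.2.1 _ hg]
  rw [hEinter]
  have hlim : Tendsto (fun m => volume.real (E m)) atTop (nhds (volume.real (⋂ m, E m))) :=
    (ENNReal.tendsto_toReal ((measure_mono (Set.iInter_subset E 0)).trans_lt
      (hEfin 0).lt_top).ne).comp (tendsto_measure_iInter_atTop
        (fun m => (hEmeas m).nullMeasurableSet) hEanti ⟨0, hEfin 0⟩)
  exact ⟨MeasurableSet.iInter hEmeas, ge_of_tendsto hlim hbound⟩

/-- A set of reals which, around each of its points, misses a fixed proportion of all small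
intervals is null. -/
lemma volume_eq_zero_of_porous_at_small_scales {s : Set ℝ}
    (h : ∀ x ∈ s, ∃ c > 0, ∀ᶠ r in nhdsWithin (0 : ℝ) (Set.Ioi 0),
      volume.real (s ∩ Metric.closedBall x r) ≤ (2 - c) * r) : volume s = 0 := by
  have hae := Besicovitch.ae_tendsto_measure_inter_div (volume : Measure ℝ) s
  rw [ae_iff] at hae
  rw [← Measure.restrict_apply_self]
  refine measure_mono_null (fun x hx => ?_) hae
  rw [Set.mem_ofPred_eq]
  intro hlim
  obtain ⟨c, hc, hx⟩ := h x hx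
  have hle : ∀ᶠ r in nhdsWithin (0 : ℝ) (Set.Ioi 0),
      volume (s ∩ Metric.closedBall x r) / volume (Metric.closedBall x r) ≤
        ENNReal.ofReal ((2 - c) / 2) := by
    filter_upwards [hx, self_mem_nhdsWithin] with r hr hr0
    have hr0 : 0 < r := hr0
    have hfin : volume (s ∩ Metric.closedBall x r) ≠ ⊤ :=
      ((measure_mono Set.inter_subset_right).trans_lt measure_closedBall_lt_top).ne
    have hpos : 0 < 2 * r := by positivity
    rw [Real.volume_closedBall, ← ofReal_measureReal hfin, ← ENNReal.ofReal_div_of_pos hpos]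
    refine ENNReal.ofReal_le_ofReal ?_
    rw [div_le_iff₀ hpos]
    linarith
  have := le_of_tendsto hlim hle
  rw [← ENNReal.ofReal_one, ENNReal.ofReal_le_ofReal_iff'] at this
  rcases this with h | h <;> linarith

/-- Finitely many functions that are locally Lipschitz at an interior point share a Lipschitz
constant on a neighbourhood of it. -/
lemma exists_common_lipschitz_nhds {ι : Type*} [Fintype ι] {f : ι → ℝ → ℝ} {I₀ : Set ℝ} {x : ℝ}
    (hx : I₀ ∈ nhds x) (hf : ∀ k, ∃ (K : NNReal) (t : Set ℝ),
      t ∈ nhdsWithin x I₀ ∧ LipschitzOnWith K (f k) t) :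
    ∃ L : ℝ, 1 ≤ L ∧ ∃ V ∈ nhds x, ∀ k, ∀ y ∈ V, ∀ z ∈ V, |f k y - f k z| ≤ L * |y - z| := by
  choose K t ht hK using hf
  refine ⟨1 + ∑ k, (K k : ℝ), le_add_of_nonneg_right (Finset.sum_nonneg fun k _ => (K k).2),
    ⋂ k, t k, ?_, fun k y hy z hz => ?_⟩
  · rw [nhdsWithin_eq_nhds.2 hx] at ht
    exact iInter_mem.2 ht
  · have h := (hK k).dist_le_mul y (Set.mem_iInter.1 hy k) z (Set.mem_iInter.1 hz k)
    rw [Real.dist_eq, Real.dist_eq] at h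
    refine h.trans (mul_le_mul_of_nonneg_right ?_ (abs_nonneg _))
    have := Finset.single_le_sum (f := fun k => (K k : ℝ)) (fun k _ => (K k).2)
      (Finset.mem_univ k)
    linarith

/-- A set of indices whose points come arbitrarily close to `y` without hitting it is infinite. -/
lemma infinite_of_frequently_near {J : Type*} {p : J → ℝ} {A : Set J} {ψ : ℕ → ℝ} {y : ℝ}
    (hψ : Tendsto ψ atTop (nhds 0)) (hy : ∀ α, y ≠ p α)
    (h : ∃ᶠ t in atTop, ∃ α ∈ A, |y - p α| < ψ t) : A.Infinite := by
  intro hA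
  have hev : ∀ᶠ t in atTop, ∀ α ∈ A, ψ t < |y - p α| := hA.eventually_all.2 fun α _ =>
    hψ.eventually_lt_const (abs_pos.2 (sub_ne_zero.2 (hy α)))
  obtain ⟨t, ⟨α, hα, hlt⟩, ht⟩ := (h.and_eventually hev).exists
  exact lt_asymm hlt (ht α hα)

theorem ubiquity_near_curve_khintchine_lemma
    (I₀ : Set ℝ) (hI₀ : I₀.OrdConnected) (hI₀b : Bornology.IsBounded I₀)
    (m : ℕ) (hm : 1 ≤ m) (f : Fin m → ℝ → ℝ)
    (hlip : ∀ k : Fin m, ∀ x ∈ I₀, ∃ (K : NNReal) (t : Set ℝ),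
      t ∈ nhdsWithin x I₀ ∧ LipschitzOnWith K (f k) t)
    (J : Type*) [Countable J] [Infinite J]
    (R1 : J → ℝ) (Rr : J → Fin m → ℝ)
    (β : J → ℝ) (hβ : ∀ α, 0 < β α)
    (hfin : ∀ t : ℕ, {α : J | β α ≤ (2 : ℝ) ^ t}.Finite)
    (Φ Ψ : ℝ → ℝ) (hΦ : IsApproxFun Φ) (hΨ : IsApproxFun Ψ)
    (ρ : ℝ → ℝ) (hρpos : ∀ t : ℝ, 0 < t → 0 < ρ t)
    (hρ0 : Tendsto ρ atTop (nhds 0))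
    (hub : LocUbiqCurve I₀ f R1 Rr β Φ ρ)
    (hreg : ∀ᶠ t : ℕ in atTop, Ψ ((2 : ℝ) ^ (t + 1)) ≤ Ψ ((2 : ℝ) ^ t) / 2)
    (hdiv : ¬ Summable (fun t : ℕ => Ψ ((2 : ℝ) ^ t) / ρ ((2 : ℝ) ^ t))) :
    volume (LambdaCurve I₀ f R1 Rr β Φ Ψ) = volume I₀ := by
  have hΨ2 : ∀ t : ℕ, 0 < Ψ ((2 : ℝ) ^ t) := fun t => hΨ.2 _ (by positivity)
  obtain ⟨κ, hκ, hub⟩ := hub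
  set D : ℕ → Set J := fun t => {α | β α ≤ (2 : ℝ) ^ t ∧ α ∈ JC f R1 Rr β Φ}
  have hD : ∀ t, (D t).Finite := fun t => (hfin t).subset fun α hα => hα.1
  have hnull : volume (interior I₀ \ (LambdaCurve I₀ f R1 Rr β Φ Ψ ∪ Set.range R1)) = 0 := by
    refine volume_eq_zero_of_porous_at_small_scales fun x hx => ?_
    have hxI : I₀ ∈ nhds x := mem_interior_iff_mem_nhds.1 hx.1
    obtain ⟨L, hL, V, hV, hLip⟩ := exists_common_lipschitz_nhds hxI fun k =>
      hlip k x (mem_of_mem_nhds hxI)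
    set ψ : ℕ → ℝ := fun t => Ψ ((2 : ℝ) ^ t) / L with hψdef
    have hψ : ∀ t, 0 < ψ t := fun t => div_pos (hΨ2 t) (by linarith)
    have hhalf : ∀ᶠ t in atTop, ψ (t + 1) ≤ ψ t / 2 := by
      filter_upwards [hreg] with t ht
      rw [hψdef, div_right_comm]
      exact div_le_div_of_nonneg_right ht (by linarith)
    have hdiv' : ¬ Summable fun t : ℕ => ψ t / ρ ((2 : ℝ) ^ t) := by
      intro h
      refine hdiv ((h.mul_left L).congr fun t => ?_)
      rw [hψdef]
      field_simp
    have hρ0' : Tendsto (fun t : ℕ => ρ ((2 : ℝ) ^ t)) atTop (nhds 0) :=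
      hρ0.comp (tendsto_pow_atTop_atTop_of_one_lt one_lt_two)
    refine ⟨min (κ / 2) (2 / 9 * (κ / 2 / 6) ^ 2), by positivity, ?_⟩
    obtain ⟨δ, hδ, hδV⟩ := Metric.nhds_basis_closedBall.mem_iff.1 (inter_mem hV hxI)
    filter_upwards [Ioo_mem_nhdsGT hδ] with r hr
    have hr0 : 0 < r := hr.1
    have hballV : Metric.closedBall x r ⊆ V ∩ I₀ :=
      (Metric.closedBall_subset_closedBall hr.2.le).trans hδV
    have hub' : ∀ᶠ t in atTop, κ / 2 * r ≤ volume.real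
        ((⋃ α ∈ D t, Metric.ball (R1 α) (ρ ((2 : ℝ) ^ t))) ∩ Metric.closedBall x (r / 2)) := by
      have h := hub (Metric.closedBall x (r / 2))
        ((Metric.closedBall_subset_closedBall (by linarith)).trans
          (hballV.trans Set.inter_subset_right)) (convex_closedBall x _).ordConnected
      have hlt : ENNReal.ofReal (κ / 2 * r) <
          ENNReal.ofReal κ * volume (Metric.closedBall x (r / 2)) := by
        rw [Real.volume_closedBall, ← ENNReal.ofReal_mul hκ.le,
          ENNReal.ofReal_lt_ofReal_iff (by positivity)]
        nlinarith [mul_pos hκ hr0]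
      filter_upwards [eventually_lt_of_lt_liminf (hlt.trans_le h)] with t ht
      rw [← Set.iUnion₂_inter] at ht
      exact (ENNReal.ofReal_le_iff_le_toReal ((measure_mono Set.inter_subset_right).trans_lt
        measure_closedBall_lt_top).ne).1 ht.le
    obtain ⟨hWmeas, hlow⟩ := le_volume_real_limsup_of_ubiquitous hD hr0 (half_pos hκ) hψ
      (fun t => hρpos _ (by positivity)) hρ0' hhalf hdiv' hub'
    set W : Set ℝ := {y ∈ Metric.closedBall x r | ∃ᶠ t in atTop,
        ∃ α ∈ D t, R1 α ∈ Metric.closedBall x r ∧ |y - R1 α| < ψ t}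
    have hWsub : W ⊆ LambdaCurve I₀ f R1 Rr β Φ Ψ ∪ Set.range R1 := by
      rintro y ⟨hy, hfreq⟩
      refine or_iff_not_imp_right.2 fun hyR => ⟨(hballV hy).2, ?_⟩
      refine infinite_of_frequently_near (p := R1)
        (tendsto_zero_of_eventually_halving hψ hhalf) (fun α h => hyR ⟨α, h.symm⟩)
        (hfreq.mono ?_)
      rintro t ⟨α, hα, hαx, hαy⟩
      refine ⟨α, ?_, hαy⟩
      have hΨα : Ψ ((2 : ℝ) ^ t) ≤ Ψ (β α) := hΨ.1 _ _ (hβ α) hα.1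
      have hLpos : 0 < L := by linarith
      have hLy : L * |y - R1 α| < Ψ (β α) := by
        rw [hψdef, lt_div_iff₀ hLpos] at hαy
        linarith
      refine ⟨by nlinarith [abs_nonneg (y - R1 α)], fun k => ?_⟩
      have h1 := hLip k y (hballV hy).1 (R1 α) (hballV hαx).1
      have h2 := hα.2 k
      linarith [abs_sub_le (f k y) (f k (R1 α)) (Rr α k)]
    have hsub : (interior I₀ \ (LambdaCurve I₀ f R1 Rr β Φ Ψ ∪ Set.range R1)) ∩
        Metric.closedBall x r ⊆ Metric.closedBall x r \ W :=
      fun y hy => ⟨hy.2, fun hyW => hy.1.2 (hWsub hyW)⟩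
    refine (measureReal_mono hsub ((measure_mono Set.sdiff_subset).trans_lt
      measure_closedBall_lt_top).ne).trans ?_
    rw [measureReal_sdiff (Set.sep_subset _ _) hWmeas measure_closedBall_lt_top.ne, Real.volume_real_closedBall hr0.le]
    linarith
  have hrange : volume (Set.range R1) = 0 := (Set.countable_range R1).measure_zero _
  have hfrontier : volume (frontier I₀) = 0 := hI₀.convex.addHaar_frontier _
  refine le_antisymm (measure_mono (Set.sep_subset _ _)) ?_
  have hcover : I₀ ⊆ LambdaCurve I₀ f R1 Rr β Φ Ψ ∪
      ((interior I₀ \ (LambdaCurve I₀ f R1 Rr β Φ Ψ ∪ Set.range R1)) ∪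
        (Set.range R1 ∪ frontier I₀)) := by
    intro y hy
    by_cases hyi : y ∈ interior I₀
    · by_cases hyΛ : y ∈ LambdaCurve I₀ f R1 Rr β Φ Ψ ∪ Set.range R1
      · exact hyΛ.imp id fun h => Or.inr (Or.inl h)
      · exact Or.inr (Or.inl ⟨hyi, hyΛ⟩)
    · exact Or.inr (Or.inr (Or.inr ⟨subset_closure hy, hyi⟩))
  refine (measure_mono hcover).trans ((measure_union_le _ _).trans_eq ?_)
  rw [measure_union_null hnull (measure_union_null hrange hfrontier), add_zero]
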